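/- arXiv:1207.2327 — 3 statements merged into one kernel-verified Lean document; each statement's English description precedes it below -/
import Mathlib

section
/- Let X be a complex Banach space and let {S_h}, {T_h} be two bounded families of operators on X that are asymptotically quasinilpotent equivalent. Then Sp({T_h}) = Sp({S_h}). -/
open Filter Topology Finset

noncomputable section

/-- The filter of approach `h → 0` within the interval `(0,1]`. -/
def zeroFilter : Filter ℝ := nhdsWithin 0 (Set.Ioc 0 1)

variable {X : Type*} [NormedAddCommGroup X] [NormedSpace ℂ X]

/-- A family of operators `(0,1] ∋ h ↦ S h` is bounded if `sup_{h ∈ (0,1]} ‖S h‖ < ∞`. -/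
def BddFamily (S : ℝ → X →L[ℂ] X) : Prop :=
  ∃ M : ℝ, ∀ h ∈ Set.Ioc (0 : ℝ) 1, ‖S h‖ ≤ M

/-- The bracket `(T - S)^{[n]} = ∑_{k=0}^{n} (-1)^{n-k} C(n,k) T^k S^{n-k}`. -/
def qBr (T S : X →L[ℂ] X) (n : ℕ) : X →L[ℂ] X :=
  ∑ k ∈ Finset.range (n + 1), ((-1 : ℂ) ^ (n - k) * (n.choose k : ℂ)) • (T ^ k * S ^ (n - k))

/-- Two families are asymptotically quasinilpotent equivalent. -/
def AsympQNEquiv (S T : ℝ → X →L[ℂ] X) : Prop :=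
  Tendsto (fun n : ℕ =>
      (Filter.limsup (fun h => ‖qBr (S h) (T h) n‖) zeroFilter) ^ ((n : ℝ)⁻¹))
    atTop (𝓝 0) ∧
  Tendsto (fun n : ℕ =>
      (Filter.limsup (fun h => ‖qBr (T h) (S h) n‖) zeroFilter) ^ ((n : ℝ)⁻¹))
    atTop (𝓝 0)

/-- `R` is an asymptotic resolvent of the family `S` at `l`: a bounded family such that
`(l I - S_h) R_h → I` and `R_h (l I - S_h) → I` in norm as `h → 0`. -/
def IsAsympResolvent (S R : ℝ → X →L[ℂ] X) (l : ℂ) : Prop :=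
  BddFamily R ∧
  Tendsto (fun h => ‖(l • (1 : X →L[ℂ] X) - S h) * R h - 1‖) zeroFilter (𝓝 0) ∧
  Tendsto (fun h => ‖R h * (l • (1 : X →L[ℂ] X) - S h) - 1‖) zeroFilter (𝓝 0)

/-- The resolvent set of a family of operators. -/
def famResolvent (S : ℝ → X →L[ℂ] X) : Set ℂ :=
  {l : ℂ | ∃ R : ℝ → X →L[ℂ] X, IsAsympResolvent S R l}

/-- The spectrum of a family of operators. -/
def famSpectrum (S : ℝ → X →L[ℂ] X) : Set ℂ :=
  (famResolvent S)ᶜ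

instance zeroFilter_neBot : zeroFilter.NeBot := by
  rw [zeroFilter, nhdsWithin_Ioc_eq_nhdsGT one_pos]
  infer_instance

theorem eventually_mem_Ioc_zeroFilter : ∀ᶠ h in zeroFilter, h ∈ Set.Ioc (0 : ℝ) 1 :=
  self_mem_nhdsWithin

/-- The bracket is the `n`-th power of the commutator-type map `A ↦ T A - A S` applied to `1`. -/
theorem qBr_eq_pow_apply (T S : X →L[ℂ] X) (n : ℕ) :
    qBr T S n = ((LinearMap.mulLeft ℂ T - LinearMap.mulRight ℂ S) ^ n) 1 := by
  have hc : Commute (LinearMap.mulLeft ℂ T) (-LinearMap.mulRight ℂ S) :=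
    (LinearMap.commute_mulLeft_right (R := ℂ) T S).neg_right
  rw [sub_eq_add_neg, hc.add_pow, LinearMap.sum_apply, qBr]
  refine Finset.sum_congr rfl fun k _ => ?_
  have hcast : ((n.choose k : ℕ) : Module.End ℂ (X →L[ℂ] X)) 1
      = (n.choose k : ℂ) • (1 : X →L[ℂ] X) := by
    rw [Module.End.natCast_apply, Nat.cast_smul_eq_nsmul]
  have hneg : (-LinearMap.mulRight ℂ S) ^ (n - k)
      = ((-1 : ℂ) ^ (n - k)) • LinearMap.mulRight ℂ (S ^ (n - k)) := by
    rw [← LinearMap.pow_mulRight, ← smul_pow, neg_one_smul]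
  rw [Module.End.mul_apply, Module.End.mul_apply, hcast, hneg, LinearMap.pow_mulLeft]
  simp [smul_smul, mul_comm]

theorem qBr_zero (T S : X →L[ℂ] X) : qBr T S 0 = 1 := by
  simp [qBr]

theorem qBr_succ (T S : X →L[ℂ] X) (n : ℕ) :
    qBr T S (n + 1) = T * qBr T S n - qBr T S n * S := by
  simp [qBr_eq_pow_apply, pow_succ']

theorem norm_one_clm_le : ‖(1 : X →L[ℂ] X)‖ ≤ 1 :=
  ContinuousLinearMap.norm_id_le

theorem norm_pow_clm_le {R : X →L[ℂ] X} {C : ℝ} (hR : ‖R‖ ≤ C) (n : ℕ) : ‖R ^ n‖ ≤ C ^ n := by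
  induction n with
  | zero => simpa using norm_one_clm_le
  | succ n ih =>
    rw [pow_succ, pow_succ]
    exact norm_mul_le_of_le ih hR

theorem norm_qBr_le {T S : X →L[ℂ] X} {a b : ℝ} (hT : ‖T‖ ≤ a) (hS : ‖S‖ ≤ b) (n : ℕ) :
    ‖qBr T S n‖ ≤ (a + b) ^ n := by
  induction n with
  | zero => simpa [qBr_zero] using norm_one_clm_le
  | succ n ih =>
    rw [qBr_succ]
    refine (norm_sub_le_of_le (norm_mul_le_of_le hT ih) (norm_mul_le_of_le ih hS)).trans_eq ?_
    ring

/-- A telescoping sum: an approximate left inverse of `l - T` built from an inverse of `l - S`. -/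
theorem sum_qBr_mul_sub {S T R : X →L[ℂ] X} {l : ℂ} (hR : R * (l • 1 - S) = 1) (N : ℕ) :
    (∑ n ∈ Finset.range N, (-1 : ℂ) ^ n • (R ^ (n + 1) * qBr S T n)) * (l • 1 - T)
      = 1 - (-1 : ℂ) ^ N • (R ^ N * qBr S T N) := by
  induction N with
  | zero => simp [qBr_zero]
  | succ N ih =>
    have hcomm : qBr S T N * (l • 1 - T) = (l • 1 - S) * qBr S T N + qBr S T (N + 1) := by
      rw [qBr_succ]
      simp only [mul_sub, sub_mul, mul_smul_comm, smul_mul_assoc, mul_one, one_mul]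
      abel
    have hpow : R ^ (N + 1) * (l • 1 - S) = R ^ N := by
      rw [pow_succ, mul_assoc, hR, mul_one]
    rw [Finset.sum_range_succ, add_mul, ih, smul_mul_assoc, mul_assoc, hcomm, mul_add,
      ← mul_assoc, hpow, pow_succ (-1 : ℂ), mul_neg_one, neg_smul, smul_add]
    abel

/-- A telescoping sum: an approximate right inverse of `l - T` built from an inverse of `l - S`. -/
theorem sub_mul_sum_qBr {S T R : X →L[ℂ] X} {l : ℂ} (hR : (l • 1 - S) * R = 1) (N : ℕ) :
    (l • 1 - T) * (∑ n ∈ Finset.range N, qBr T S n * R ^ (n + 1))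
      = 1 - qBr T S N * R ^ N := by
  induction N with
  | zero => simp [qBr_zero]
  | succ N ih =>
    have hcomm : (l • 1 - T) * qBr T S N = qBr T S N * (l • 1 - S) - qBr T S (N + 1) := by
      rw [qBr_succ]
      simp only [mul_sub, sub_mul, mul_smul_comm, smul_mul_assoc, mul_one, one_mul]
      abel
    have hpow : (l • 1 - S) * R ^ (N + 1) = R ^ N := by
      rw [pow_succ', ← mul_assoc, hR, one_mul]
    rw [Finset.sum_range_succ, mul_add, ih, ← mul_assoc, hcomm, sub_mul, mul_assoc, hpow]
    abel

theorem exists_inverse_of_norm_sub_one_le [CompleteSpace X] {U : X →L[ℂ] X}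
    (hU : ‖U - 1‖ ≤ 1 / 2) : ∃ V : X →L[ℂ] X, V * U = 1 ∧ U * V = 1 ∧ ‖V‖ ≤ 2 := by
  have hlt : ‖1 - U‖ < 1 := by
    rw [norm_sub_rev]
    linarith
  obtain ⟨u, hu⟩ : IsUnit U := by
    simpa using isUnit_one_sub_of_norm_lt_one hlt
  refine ⟨↑u⁻¹, by simp [← hu], by simp [← hu], ?_⟩
  have hV : (↑u⁻¹ : X →L[ℂ] X) = 1 - ↑u⁻¹ * (U - 1) := by
    simp [← hu, mul_sub]
  have hle := norm_sub_le_of_le (norm_one_clm_le (X := X))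
    (norm_mul_le_of_le (le_refl ‖(↑u⁻¹ : X →L[ℂ] X)‖) hU)
  rw [← hV] at hle
  linarith

/-- Approximate one-sided inverses on both sides yield an exact two-sided inverse. -/
theorem exists_inverse_of_approx [CompleteSpace X] {A P Q : X →L[ℂ] X} {K : ℝ}
    (hPA : ‖P * A - 1‖ ≤ 1 / 2) (hAQ : ‖A * Q - 1‖ ≤ 1 / 2) (hP : ‖P‖ ≤ K) :
    ∃ B : X →L[ℂ] X, ‖B‖ ≤ 2 * K ∧ A * B = 1 ∧ B * A = 1 := by
  obtain ⟨V, hV, -, hVn⟩ := exists_inverse_of_norm_sub_one_le hPA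
  obtain ⟨W, -, hW, -⟩ := exists_inverse_of_norm_sub_one_le hAQ
  have hl : V * P * A = 1 := by rw [mul_assoc, hV]
  have hr : A * (Q * W) = 1 := by rw [← mul_assoc, hW]
  refine ⟨V * P, norm_mul_le_of_le hVn hP, ?_, hl⟩
  rw [left_inv_eq_right_inv hl hr, hr]

/-- A point is in the resolvent set iff exact inverses exist and are bounded for small `h`. -/
theorem mem_famResolvent_iff [CompleteSpace X] {S : ℝ → X →L[ℂ] X} {l : ℂ} :
    l ∈ famResolvent S ↔ ∃ C : ℝ, ∀ᶠ h in zeroFilter, ∃ R : X →L[ℂ] X,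
      ‖R‖ ≤ C ∧ (l • 1 - S h) * R = 1 ∧ R * (l • 1 - S h) = 1 := by
  constructor
  · rintro ⟨R, ⟨M, hM⟩, h₁, h₂⟩
    refine ⟨2 * M, ?_⟩
    filter_upwards [h₁.eventually_le_const (u := 1 / 2) (by norm_num),
      h₂.eventually_le_const (u := 1 / 2) (by norm_num), eventually_mem_Ioc_zeroFilter]
      with h hr hl hh
    exact exists_inverse_of_approx hl hr (hM h hh)
  · rintro ⟨C, hC⟩
    classical
    let R : ℝ → X →L[ℂ] X := fun h =>
      if H : ∃ R : X →L[ℂ] X, ‖R‖ ≤ C ∧ (l • 1 - S h) * R = 1 ∧ R * (l • 1 - S h) = 1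
      then H.choose else 0
    have hR : ∀ᶠ h in zeroFilter, (l • 1 - S h) * R h = 1 ∧ R h * (l • 1 - S h) = 1 := by
      filter_upwards [hC] with h H
      simpa only [R, dif_pos H] using H.choose_spec.2
    refine ⟨R, ⟨max C 0, fun h _ => ?_⟩, ?_, ?_⟩
    · by_cases H : ∃ R : X →L[ℂ] X, ‖R‖ ≤ C ∧ (l • 1 - S h) * R = 1 ∧ R * (l • 1 - S h) = 1
      · simpa only [R, dif_pos H] using H.choose_spec.1.trans (le_max_left _ _)
      · simp [R, dif_neg H]
    · refine tendsto_const_nhds.congr' ?_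
      filter_upwards [hR] with h H
      simp [H.1]
    · refine tendsto_const_nhds.congr' ?_
      filter_upwards [hR] with h H
      simp [H.2]

/-- If the `n`-th roots of the limsups of the brackets tend to `0`, the brackets are eventually
smaller than any geometric sequence. -/
theorem eventually_norm_qBr_lt {S T : ℝ → X →L[ℂ] X} (hS : BddFamily S) (hT : BddFamily T)
    (hQ : Tendsto (fun n : ℕ =>
      (Filter.limsup (fun h => ‖qBr (S h) (T h) n‖) zeroFilter) ^ ((n : ℝ)⁻¹)) atTop (𝓝 0))
    {ε : ℝ} (hε : 0 < ε) :
    ∀ᶠ n : ℕ in atTop, ∀ᶠ h in zeroFilter, ‖qBr (S h) (T h) n‖ < ε ^ n := by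
  obtain ⟨a, ha⟩ := hS
  obtain ⟨b, hb⟩ := hT
  filter_upwards [hQ.eventually_lt_const hε, eventually_gt_atTop 0] with n hn hpos
  have hbdd : zeroFilter.IsBoundedUnder (· ≤ ·) fun h => ‖qBr (S h) (T h) n‖ := by
    refine isBoundedUnder_of_eventually_le (a := (a + b) ^ n) ?_
    filter_upwards [eventually_mem_Ioc_zeroFilter] with h hh
    exact norm_qBr_le (ha h hh) (hb h hh) n
  have hnonneg : 0 ≤ Filter.limsup (fun h => ‖qBr (S h) (T h) n‖) zeroFilter :=
    le_limsup_of_frequently_le (Frequently.of_forall fun h => norm_nonneg _) hbdd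
  refine eventually_lt_of_limsup_lt ?_ hbdd
  rw [Real.rpow_inv_lt_iff_of_pos hnonneg hε.le (by exact_mod_cast hpos)] at hn
  exact_mod_cast hn

theorem famResolvent_subset [CompleteSpace X] {S T : ℝ → X →L[ℂ] X}
    (hS : BddFamily S) (hT : BddFamily T) (hQN : AsympQNEquiv S T) :
    famResolvent S ⊆ famResolvent T := by
  intro l hl
  obtain ⟨C₀, hC₀⟩ := mem_famResolvent_iff.1 hl
  obtain ⟨C, hCpos, hC₀C⟩ : ∃ C : ℝ, 0 < C ∧ C₀ ≤ C :=
    ⟨max C₀ 1, by positivity, le_max_left _ _⟩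
  have hε : 0 < (2 * C)⁻¹ := by positivity
  obtain ⟨N, ⟨hN₁, hN₂⟩, hN⟩ := ((eventually_norm_qBr_lt hS hT hQN.1 hε).and
    (eventually_norm_qBr_lt hT hS hQN.2 hε)).and (eventually_ge_atTop 1) |>.exists
  have hsmall : C ^ N * (2 * C)⁻¹ ^ N ≤ 1 / 2 := by
    rw [← mul_pow, show C * (2 * C)⁻¹ = 1 / 2 by field_simp]
    exact pow_le_of_le_one (by norm_num) (by norm_num) (by omega)
  obtain ⟨a, ha⟩ := hS
  obtain ⟨b, hb⟩ := hT
  refine mem_famResolvent_iff.2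
    ⟨2 * ∑ n ∈ Finset.range N, C ^ (n + 1) * (a + b) ^ n, ?_⟩
  filter_upwards [hC₀, hN₁, hN₂, eventually_mem_Ioc_zeroFilter] with h ⟨R, hR, hr, hl⟩ h₁ h₂ hh
  replace hR := hR.trans hC₀C
  refine exists_inverse_of_approx
    (P := ∑ n ∈ Finset.range N, (-1 : ℂ) ^ n • (R ^ (n + 1) * qBr (S h) (T h) n))
    (Q := ∑ n ∈ Finset.range N, qBr (T h) (S h) n * R ^ (n + 1)) ?_ ?_ ?_
  · rw [sum_qBr_mul_sub hl, sub_sub_cancel_left, norm_neg, norm_smul, norm_pow, norm_neg,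
      norm_one, one_pow, one_mul]
    exact (norm_mul_le_of_le (norm_pow_clm_le hR N) h₁.le).trans hsmall
  · rw [sub_mul_sum_qBr hr, sub_sub_cancel_left, norm_neg]
    refine (norm_mul_le_of_le h₂.le (norm_pow_clm_le hR N)).trans ?_
    rwa [mul_comm]
  · refine norm_sum_le_of_le _ fun n _ => ?_
    rw [norm_smul, norm_pow, norm_neg, norm_one, one_pow, one_mul]
    exact norm_mul_le_of_le (norm_pow_clm_le hR _) (norm_qBr_le (ha h hh) (hb h hh) n)

theorem stmt0 {X : Type*} [NormedAddCommGroup X] [NormedSpace ℂ X] [CompleteSpace X]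
    (S T : ℝ → X →L[ℂ] X) (hS : BddFamily S) (hT : BddFamily T)
    (hQN : AsympQNEquiv S T) :
    famSpectrum T = famSpectrum S :=
  congrArg compl <| (famResolvent_subset hT hS ⟨hQN.2, hQN.1⟩).antisymm
    (famResolvent_subset hS hT hQN)
end
end

section
/- (Asymptotic resolvent equation) Let X be a complex Banach space, {S_h} a bounded family of operators on X, and λ, μ ∈ r({S_h}). If {R_h(λ)} is an asymptotic resolvent of {S_h} at λ and {R_h(μ)} is an asymptotic resolvent of {S_h} at μ, then lim_{h→0} ‖R_h(λ) − R_h(μ) − (μ − λ) R_h(λ) R_h(μ)‖ = 0. -/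
open Filter Topology Finset

noncomputable section

variable {X : Type*} [NormedAddCommGroup X] [NormedSpace ℂ X]

/-- A bounded family is bounded by a constant along the filter `h → 0`. -/
theorem BddFamily.isBoundedUnder {S : ℝ → X →L[ℂ] X} (hS : BddFamily S) :
    IsBoundedUnder (· ≤ ·) zeroFilter (fun h => ‖S h‖) := by
  obtain ⟨M, hM⟩ := hS
  exact ⟨M, eventually_map.2 (eventually_mem_nhdsWithin.mono hM)⟩

/-- The defect in the resolvent equation, in terms of the one-sided inverse defects. -/
theorem resolvent_defect_eq (S A B : X →L[ℂ] X) (l μ : ℂ) :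
    A - B - (μ - l) • (A * B) =
      (A * (l • (1 : X →L[ℂ] X) - S) - 1) * B - A * ((μ • (1 : X →L[ℂ] X) - S) * B - 1) := by
  simp only [sub_mul, mul_sub, smul_mul_assoc, mul_smul_comm, one_mul, mul_one, sub_smul,
    mul_assoc]
  abel

theorem stmt7 {X : Type*} [NormedAddCommGroup X] [NormedSpace ℂ X] [CompleteSpace X]
    (S : ℝ → X →L[ℂ] X) (hS : BddFamily S) (l μ : ℂ)
    (hl : l ∈ famResolvent S) (hμ : μ ∈ famResolvent S)
    (Rl Rμ : ℝ → X →L[ℂ] X)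
    (hRl : IsAsympResolvent S Rl l) (hRμ : IsAsympResolvent S Rμ μ) :
    Tendsto (fun h => ‖Rl h - Rμ h - (μ - l) • (Rl h * Rμ h)‖) zeroFilter (𝓝 0) := by
  have hE := tendsto_zero_iff_norm_tendsto_zero.2 hRl.2.2
  have hF := tendsto_zero_iff_norm_tendsto_zero.2 hRμ.2.1
  have h₁ := hE.zero_mul_isBoundedUnder_le hRμ.1.isBoundedUnder
  have h₂ := isBoundedUnder_le_mul_tendsto_zero hRl.1.isBoundedUnder hF
  have h := (h₁.sub h₂).norm
  rw [sub_zero, norm_zero] at h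
  exact h.congr fun t => by rw [resolvent_defect_eq (S t)]
end
end

section
/- Let X be a complex Banach space, {S_h} a bounded family of operators on X, and let λ, μ ∈ r({S_h}) with λ ≠ μ. If {R_h(λ)} is an asymptotic resolvent of {S_h} at λ and {R_h(μ)} is an asymptotic resolvent of {S_h} at μ, then lim_{h→0} ‖R_h(λ) R_h(μ) − R_h(μ) R_h(λ)‖ = 0. -/
open Filter Topology Finset

noncomputable section

variable {X : Type*} [NormedAddCommGroup X] [NormedSpace ℂ X]

/-- The commutator of `R` and `Q` in terms of the defects of `R` and `Q` as inverses of `A` and `B`,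
when `A` and `B` have the same commutator with `Q`. -/
theorem commutator_eq_of_defects {𝓐 : Type*} [Ring 𝓐] (A B R Q : 𝓐)
    (hAB : Q * A - A * Q = Q * B - B * Q) :
    R * Q - Q * R =
      R * ((Q * B - 1) - (B * Q - 1)) * R - R * Q * (A * R - 1) + (R * A - 1) * (Q * R) := by
  have h : (Q * B - 1) - (B * Q - 1) = Q * A - A * Q := by rw [hAB]; abel
  rw [h]
  noncomm_ring

/-- The commutator of two operators is controlled by the defects of the operators as inverses. -/
theorem norm_commutator_le_of_defects {𝓐 : Type*} [NormedRing 𝓐] (A B R Q : 𝓐)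
    (hAB : Q * A - A * Q = Q * B - B * Q) {M N : ℝ} (hR : ‖R‖ ≤ M) (hQ : ‖Q‖ ≤ N) :
    ‖R * Q - Q * R‖ ≤ M * (‖Q * B - 1‖ + ‖B * Q - 1‖) * M + M * N * ‖A * R - 1‖
      + ‖R * A - 1‖ * (N * M) := by
  have hM : 0 ≤ M := (norm_nonneg R).trans hR
  have hN : 0 ≤ N := (norm_nonneg Q).trans hQ
  rw [commutator_eq_of_defects A B R Q hAB]
  refine (norm_add_le _ _).trans (add_le_add ((norm_sub_le _ _).trans (add_le_add ?_ ?_)) ?_)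
  · refine norm_mul_le_of_le (norm_mul_le_of_le hR (norm_sub_le _ _)) hR
  · exact norm_mul_le_of_le (norm_mul_le_of_le hR hQ) le_rfl
  · exact norm_mul_le_of_le le_rfl (norm_mul_le_of_le hQ hR)

theorem stmt8 {X : Type*} [NormedAddCommGroup X] [NormedSpace ℂ X] [CompleteSpace X]
    (S : ℝ → X →L[ℂ] X) (hS : BddFamily S) (l μ : ℂ) (hne : l ≠ μ)
    (hl : l ∈ famResolvent S) (hμ : μ ∈ famResolvent S)
    (Rl Rμ : ℝ → X →L[ℂ] X)
    (hRl : IsAsympResolvent S Rl l) (hRμ : IsAsympResolvent S Rμ μ) :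
    Tendsto (fun h => ‖Rl h * Rμ h - Rμ h * Rl h‖) zeroFilter (𝓝 0) := by 
  obtain ⟨⟨M, hM⟩, hAR, hRA⟩ := hRl
  obtain ⟨⟨N, hN⟩, hBQ, hQB⟩ := hRμ
  have hlim := (((hQB.add hBQ).const_mul M).mul_const M).add (hAR.const_mul (M * N))
    |>.add (hRA.mul_const (N * M))
  simp only [add_zero, mul_zero, zero_mul] at hlim
  refine squeeze_zero' (Eventually.of_forall fun h => norm_nonneg _) ?_ hlim
  filter_upwards [self_mem_nhdsWithin] with h hh
  refine norm_commutator_le_of_defects _ _ _ _ ?_ (hM h hh) (hN h hh)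
  simp only [mul_sub, sub_mul, mul_smul_comm, smul_mul_assoc, mul_one, one_mul]
  abel
end
end
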